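/- arXiv:2107.00748 — 2 statements merged into one kernel-verified Lean document; each statement's English description precedes it below -/
import Mathlib

section
/- Let T = (T_a, T_b) be a rooted binary phylogenetic X-tree with |X| = n ≥ 3, where T_a and T_b have n_a and n_b leaves respectively with n_a ≥ n_b. Then there exists an assignment of strictly positive edge lengths to T such that the ranking induced by FP_T is strict and such that, when the leaf x' with minimal FP_T value is deleted (x' being distinct from x* := argmax_{x ∈ X} FP_T(x)) to derive the induced subtree T̃ = T_{X∖{x'}}, exactly n_a − 1 leaves have a higher FP_{T̃} value than x* in T̃. -/
open scoped Classical

namespace Phylo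

/-- A rooted binary phylogenetic tree with leaf labels of type `α`.
`node l r a b` is a tree whose root has two children: the roots of `l` and `r`,
where `a` is the length of the edge to the root of `l` and `b` the length of the
edge to the root of `r`.  A tree `leaf x` consists of a single vertex labelled `x`. -/
inductive PhyloTree (α : Type) : Type where
  | leaf : α → PhyloTree α
  | node : PhyloTree α → PhyloTree α → ℝ → ℝ → PhyloTree α

namespace PhyloTree

variable {α : Type} [DecidableEq α]

/-- The set of leaf labels of a tree. -/
def leafSet : PhyloTree α → Finset α
  | leaf x => {x}
  | node l r _ _ => leafSet l ∪ leafSet r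

/-- The number of leaves of a tree. -/
def numLeaves (T : PhyloTree α) : ℕ := T.leafSet.card

/-- All edge lengths of the tree are strictly positive. -/
def posLengths : PhyloTree α → Prop
  | leaf _ => True
  | node l r a b => 0 < a ∧ 0 < b ∧ posLengths l ∧ posLengths r

/-- The leaves of the tree are bijectively labelled (no label occurs twice);
this makes `T` a phylogenetic `X`-tree with `X = T.leafSet`. -/
def distinctLeaves : PhyloTree α → Prop
  | leaf _ => True
  | node l r _ _ => Disjoint l.leafSet r.leafSet ∧ distinctLeaves l ∧ distinctLeaves r

/-- The Fair Proportion index `FP_T(x)`: every edge `e` on the path from the root to `x`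
contributes `λ_e / D_e`, where `D_e` is the number of leaves descended from `e`. -/
noncomputable def FP : PhyloTree α → α → ℝ
  | leaf _, _ => 0
  | node l r a b, x =>
    if x ∈ l.leafSet then FP l x + a / (l.numLeaves : ℝ)
    else if x ∈ r.leafSet then FP r x + b / (r.numLeaves : ℝ)
    else 0

/-- Helper for the induced subtree: `restrict? T Y` returns `none` if no leaf of `T`
survives, and otherwise `some (e, T')` where `T'` is the induced subtree on the
surviving leaves and `e` is the total length of the suppressed unary chain of edges
above the root of `T'` (merged edge lengths are added). -/
noncomputable def restrict? : PhyloTree α → Finset α → Option (ℝ × PhyloTree α)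
  | leaf x, Y => if x ∈ Y then some (0, leaf x) else none
  | node l r a b, Y =>
    match restrict? l Y, restrict? r Y with
    | some (ea, l'), some (eb, r') => some (0, node l' r' (a + ea) (b + eb))
    | some (ea, l'), none => some (a + ea, l')
    | none, some (eb, r') => some (b + eb, r')
    | none, none => none

/-- The induced subtree `T_Y` of `T` on the leaf set `Y` (non-root degree-2 vertices are
suppressed, merged edge lengths are added, and a dangling root edge is deleted).
Junk value `T` if no leaf survives. -/
noncomputable def restrictTree (T : PhyloTree α) (Y : Finset α) : PhyloTree α :=
  match T.restrict? Y with
  | some (_, t) => t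
  | none => T

/-- The ranking induced by `FP_T` is strict: `FP_T` is injective on the leaf set. -/
def strict (T : PhyloTree α) : Prop := Set.InjOn T.FP ↑T.leafSet

/-- The ranking induced by `FP_T` is reversible with respect to `X' ⊂ X`: writing
`T̃ = T_{X \ X'}`, for all surviving leaves `x, y` we have
`FP_T x > FP_T y ↔ FP_T̃ x < FP_T̃ y`. -/
def reversible (T : PhyloTree α) (X' : Finset α) : Prop :=
  ∀ x ∈ T.leafSet \ X', ∀ y ∈ T.leafSet \ X',
    (T.FP y < T.FP x ↔
      (T.restrictTree (T.leafSet \ X')).FP x < (T.restrictTree (T.leafSet \ X')).FP y)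

/-- The cherries of `T`: pairs of leaves sharing the same parent. -/
def cherries : PhyloTree α → Finset (α × α)
  | leaf _ => ∅
  | node (leaf x) (leaf y) _ _ => {(x, y)}
  | node l r _ _ => cherries l ∪ cherries r

/-- `X'` consists of precisely one leaf out of each cherry of `T`. -/
def oneLeafPerCherry (T : PhyloTree α) (X' : Finset α) : Prop :=
  (∀ x ∈ X', ∃ p ∈ T.cherries, x = p.1 ∨ x = p.2) ∧
  ∀ p ∈ T.cherries, (p.1 ∈ X' ∧ p.2 ∉ X') ∨ (p.1 ∉ X' ∧ p.2 ∈ X')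

/-- Two trees have the same shape and the same leaf labelling
(only the edge lengths may differ). -/
def sameShape : PhyloTree α → PhyloTree α → Prop
  | leaf x, leaf y => x = y
  | node l r _ _, node l' r' _ _ => sameShape l l' ∧ sameShape r r'
  | _, _ => False

/-- `T.hasSubtree s`: `s` occurs as a (pendant) subtree of `T`. -/
def hasSubtree : PhyloTree α → PhyloTree α → Prop
  | leaf x, s => leaf x = s
  | node l r a b, s => node l r a b = s ∨ hasSubtree l s ∨ hasSubtree r s

/-- The total edge length of the path from the root to the leaf `x`. -/
noncomputable def depth : PhyloTree α → α → ℝ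
  | leaf _, _ => 0
  | node l r a b, x =>
    if x ∈ l.leafSet then depth l x + a
    else if x ∈ r.leafSet then depth r x + b
    else 0

/-- `T` is ultrametric: all leaves have the same distance to the root. -/
def ultrametric (T : PhyloTree α) : Prop :=
  ∀ x ∈ T.leafSet, ∀ y ∈ T.leafSet, T.depth x = T.depth y

/-- The total sum of the edge lengths of `T`. -/
noncomputable def totalLength : PhyloTree α → ℝ
  | leaf _ => 0
  | node l r a b => a + b + totalLength l + totalLength r

/-- Whether the tree is a single leaf. -/
def isLeafB : PhyloTree α → Bool
  | leaf _ => true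
  | node _ _ _ _ => false

/-- Multiply all edge lengths of `T` by `k`. -/
noncomputable def scale (k : ℝ) : PhyloTree α → PhyloTree α
  | leaf x => leaf x
  | node l r a b => node (scale k l) (scale k r) (k * a) (k * b)

/-- Add `d` to the length of every pendant edge (edge incident to a leaf) of `T`. -/
noncomputable def addPendant (d : ℝ) : PhyloTree α → PhyloTree α
  | leaf x => leaf x
  | node l r a b =>
    node (addPendant d l) (addPendant d r)
      (if l.isLeafB then a + d else a) (if r.isLeafB then b + d else b)

end PhyloTree

end Phylo

open Phylo PhyloTree

namespace Phylo
namespace PhyloTree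

theorem aux_nonempty {α : Type} [DecidableEq α] (T : PhyloTree α) : T.leafSet.Nonempty := by
  induction T with
  | leaf x => simp [leafSet]
  | node l r a b ihl ihr => simp only [leafSet]; exact ihl.mono Finset.subset_union_left

theorem aux_FP_nonneg {α : Type} [DecidableEq α] (T : PhyloTree α) (h : T.posLengths) (x : α) :
    0 ≤ T.FP x := by
  induction T with
  | leaf y => simp [FP]
  | node l r a b ihl ihr =>
    obtain ⟨ha, hb, hl, hr⟩ := h
    have h1 := ihl hl
    have h2 := ihr hr
    simp only [FP]
    split_ifs
    · positivity
    · positivity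
    · exact le_refl _

theorem aux_FP_left {α : Type} [DecidableEq α] (l r : PhyloTree α) (a b : ℝ) (x : α)
    (h : x ∈ l.leafSet) : (node l r a b).FP x = l.FP x + a / (l.numLeaves : ℝ) := by
  simp [FP, h]

theorem aux_FP_right {α : Type} [DecidableEq α] (l r : PhyloTree α) (a b : ℝ) (x : α)
    (hd : Disjoint l.leafSet r.leafSet)
    (h : x ∈ r.leafSet) : (node l r a b).FP x = r.FP x + b / (r.numLeaves : ℝ) := by
  have : x ∉ l.leafSet := fun h' => Finset.disjoint_left.mp hd h' h
  simp [FP, h, this]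

theorem aux_numLeaves_pos {α : Type} [DecidableEq α] (T : PhyloTree α) :
    (0 : ℝ) < (T.numLeaves : ℝ) := by
  exact_mod_cast Finset.card_pos.mpr (aux_nonempty T)

theorem aux_join_strict {α : Type} [DecidableEq α] (l r : PhyloTree α) (a b c : ℝ)
    (hd : Disjoint l.leafSet r.leafSet) (hl : l.strict) (hr : r.strict)
    (h1 : ∀ x ∈ l.leafSet, (node l r a b).FP x < c)
    (h2 : ∀ x ∈ r.leafSet, c ≤ (node l r a b).FP x) : (node l r a b).strict := by
  intro x hx y hy hxy
  simp only [leafSet, Finset.coe_union, Set.mem_union, Finset.mem_coe] at hx hy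
  rcases hx with hx | hx <;> rcases hy with hy | hy
  · rw [aux_FP_left _ _ _ _ _ hx, aux_FP_left _ _ _ _ _ hy] at hxy
    exact hl hx hy (by linarith)
  · have := h1 x hx
    have := h2 y hy
    linarith
  · have := h1 y hy
    have := h2 x hx
    linarith
  · rw [aux_FP_right _ _ _ _ _ hd hx, aux_FP_right _ _ _ _ _ hd hy] at hxy
    exact hr hx hy (by linarith)

theorem aux_exists_strict {α : Type} [DecidableEq α] (T : PhyloTree α) (h : T.distinctLeaves) :
    ∃ (S : PhyloTree α) (M : ℝ), T.sameShape S ∧ S.distinctLeaves ∧ S.posLengths ∧ S.strict ∧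
      S.leafSet = T.leafSet ∧ 0 < M ∧ ∀ x ∈ S.leafSet, S.FP x < M := by
  induction T with
  | leaf x =>
    refine ⟨leaf x, 1, rfl, trivial, trivial, ?_, rfl, one_pos, ?_⟩
    · simp [strict, leafSet]
    · simp [FP]
  | node l r a b ihl ihr =>
    obtain ⟨hd, hl, hr⟩ := h
    obtain ⟨l', M, hl1, hl2, hl3, hl4, hl5, hM, hl6⟩ := ihl hl
    obtain ⟨r', N, hr1, hr2, hr3, hr4, hr5, hN, hr6⟩ := ihr hr
    have hnl := aux_numLeaves_pos l'
    have hnr := aux_numLeaves_pos r'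
    rw [← hl5, ← hr5] at hd
    set T' := node l' r' (l'.numLeaves * 1) (r'.numLeaves * (M + 1)) with hT'
    have e1 : ∀ x ∈ l'.leafSet, T'.FP x = l'.FP x + 1 := by
      intro x hx
      rw [hT', aux_FP_left _ _ _ _ _ hx]
      field_simp
    have e2 : ∀ x ∈ r'.leafSet, T'.FP x = r'.FP x + (M + 1) := by
      intro x hx
      rw [hT', aux_FP_right _ _ _ _ _ hd hx]
      field_simp
    have b1 : ∀ x ∈ l'.leafSet, T'.FP x < M + 1 := by
      intro x hx
      rw [e1 x hx]
      linarith [hl6 x hx]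
    have b2 : ∀ x ∈ r'.leafSet, M + 1 ≤ T'.FP x := by
      intro x hx
      rw [e2 x hx]
      linarith [aux_FP_nonneg r' hr3 x]
    refine ⟨T', M + N + 1, ⟨hl1, hr1⟩, ⟨hd, hl2, hr2⟩,
      ⟨by positivity, by positivity, hl3, hr3⟩, aux_join_strict _ _ _ _ _ hd hl4 hr4 b1 b2, ?_,
      by positivity, ?_⟩
    · simp [hT', leafSet, hl5, hr5]
    · intro x hx
      simp only [hT', leafSet, Finset.mem_union] at hx
      rcases hx with hx | hx
      · linarith [b1 x hx]
      · rw [e2 x hx]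
        linarith [hr6 x hx]

theorem aux_restrict_none {α : Type} [DecidableEq α] (T : PhyloTree α) (Y : Finset α)
    (h : Disjoint T.leafSet Y) : T.restrict? Y = none := by
  induction T with
  | leaf x =>
    simp only [leafSet, Finset.disjoint_singleton_left] at h
    simp [restrict?, h]
  | node l r a b ihl ihr =>
    simp only [leafSet, Finset.disjoint_union_left] at h
    simp [restrict?, ihl h.1, ihr h.2]

theorem aux_restrict_all {α : Type} [DecidableEq α] (T : PhyloTree α) (Y : Finset α)
    (h : T.leafSet ⊆ Y) : T.restrict? Y = some (0, T) := by
  induction T with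
  | leaf x =>
    simp only [leafSet, Finset.singleton_subset_iff] at h
    simp [restrict?, h]
  | node l r a b ihl ihr =>
    simp only [leafSet, Finset.union_subset_iff] at h
    simp [restrict?, ihl h.1, ihr h.2]

theorem aux_restrict_some {α : Type} [DecidableEq α] (T : PhyloTree α) (Y : Finset α)
    (hp : T.posLengths) (h : ¬ Disjoint T.leafSet Y) :
    ∃ e t, T.restrict? Y = some (e, t) ∧ 0 ≤ e ∧ t.leafSet = T.leafSet ∩ Y ∧ t.posLengths := by
  induction T with
  | leaf x =>
    simp only [leafSet, Finset.disjoint_singleton_left, not_not] at h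
    exact ⟨0, leaf x, by simp [restrict?, h], le_refl _, by simp [leafSet, h], trivial⟩
  | node l r a b ihl ihr =>
    obtain ⟨ha, hb, hl, hr⟩ := hp
    by_cases h1 : Disjoint l.leafSet Y <;> by_cases h2 : Disjoint r.leafSet Y
    · exact absurd (by simp only [leafSet, Finset.disjoint_union_left]; exact ⟨h1, h2⟩) h
    · obtain ⟨e, t, q1, q2, q3, q4⟩ := ihr hr h2
      refine ⟨b + e, t, by simp [restrict?, q1, aux_restrict_none _ _ h1], by positivity, ?_, q4⟩
      rw [q3, leafSet, Finset.union_inter_distrib_right, Finset.disjoint_iff_inter_eq_empty.mp h1,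
        Finset.empty_union]
    · obtain ⟨e, t, q1, q2, q3, q4⟩ := ihl hl h1
      refine ⟨a + e, t, by simp [restrict?, q1, aux_restrict_none _ _ h2], by positivity, ?_, q4⟩
      rw [q3, leafSet, Finset.union_inter_distrib_right, Finset.disjoint_iff_inter_eq_empty.mp h2,
        Finset.union_empty]
    · obtain ⟨e, t, q1, q2, q3, q4⟩ := ihl hl h1
      obtain ⟨e', t', p1, p2, p3, p4⟩ := ihr hr h2
      refine ⟨0, node t t' (a + e) (b + e'), by simp [restrict?, q1, p1], le_refl _, ?_,
        ⟨by positivity, by positivity, q4, p4⟩⟩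
      simp only [leafSet]
      rw [q3, p3, Finset.union_inter_distrib_right]

end PhyloTree
end Phylo

/-- For every tree shape `T = (T_a, T_b)` with `n ≥ 3` leaves and
`n_a ≥ n_b` there are strictly positive edge lengths making the FP ranking strict
such that, when the leaf `x'` of minimal FP value (distinct from the leaf `x*` of maximal
FP value) is deleted, exactly `n_a - 1` leaves have a higher FP value than `x*` in the
induced subtree. -/
theorem exists_lengths_achieving_overtake_bound {α : Type} [DecidableEq α]
    (Ta Tb : PhyloTree α) (la lb : ℝ) (T : PhyloTree α)
    (hT : T = PhyloTree.node Ta Tb la lb)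
    (hleaf : T.distinctLeaves)
    (hn : 3 ≤ T.numLeaves) (hab : Tb.numLeaves ≤ Ta.numLeaves) :
    ∃ T' : PhyloTree α, T.sameShape T' ∧ T'.distinctLeaves ∧ T'.posLengths ∧ T'.strict ∧
      ∃ xstar ∈ T'.leafSet, ∃ x' ∈ T'.leafSet, x' ≠ xstar ∧
        (∀ y ∈ T'.leafSet, y ≠ xstar → T'.FP y < T'.FP xstar) ∧
        (∀ y ∈ T'.leafSet, y ≠ x' → T'.FP x' < T'.FP y) ∧
        ((T'.leafSet \ {x'}).filter
            (fun z => (T'.restrictTree (T'.leafSet \ {x'})).FP xstar <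
                      (T'.restrictTree (T'.leafSet \ {x'})).FP z)).card
          = Ta.numLeaves - 1 := by
  subst hT
  obtain ⟨hd, hda, hdb⟩ := hleaf
  have hna : 2 ≤ Ta.numLeaves := by
    have : (PhyloTree.node Ta Tb la lb).numLeaves ≤ Ta.numLeaves + Tb.numLeaves :=
      Finset.card_union_le _ _
    omega
  obtain ⟨A, M, a1, a2, a3, a4, a5, hM, a6⟩ := aux_exists_strict Ta hda
  obtain ⟨B, N, b1, b2, b3, b4, b5, hN, b6⟩ := aux_exists_strict Tb hdb
  rw [← a5, ← b5] at hd
  have hnA : A.numLeaves = Ta.numLeaves := by simp only [numLeaves, a5]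
  rw [← hnA] at hna ⊢
  have hA := aux_numLeaves_pos A
  have hB := aux_numLeaves_pos B
  set K : ℝ := A.numLeaves * (M + N) with hK
  have hKpos : 0 < K := by positivity
  set S := PhyloTree.node A B (A.numLeaves * K) (B.numLeaves * (K + M)) with hS
  have eA : ∀ x ∈ A.leafSet, S.FP x = A.FP x + K := by
    intro x hx
    rw [hS, aux_FP_left _ _ _ _ _ hx]
    field_simp
  have eB : ∀ x ∈ B.leafSet, S.FP x = B.FP x + (K + M) := by
    intro x hx
    rw [hS, aux_FP_right _ _ _ _ _ hd hx]
    field_simp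
  have cA : ∀ x ∈ A.leafSet, S.FP x < K + M := by
    intro x hx
    rw [eA x hx]
    linarith [a6 x hx]
  have cB : ∀ x ∈ B.leafSet, K + M ≤ S.FP x := by
    intro x hx
    rw [eB x hx]
    linarith [aux_FP_nonneg B b3 x]
  have hstrict : S.strict := aux_join_strict _ _ _ _ _ hd a4 b4 cA cB
  have hmem : ∀ y, y ∈ S.leafSet ↔ y ∈ A.leafSet ∨ y ∈ B.leafSet := by
    intro y
    simp [hS, leafSet]
  obtain ⟨xs, hxs, hmax⟩ := Finset.exists_max_image B.leafSet S.FP (aux_nonempty B)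
  obtain ⟨x', hx', hmin⟩ := Finset.exists_min_image A.leafSet S.FP (aux_nonempty A)
  have hxsS : xs ∈ S.leafSet := (hmem _).2 (Or.inr hxs)
  have hx'S : x' ∈ S.leafSet := (hmem _).2 (Or.inl hx')
  have hx'B : x' ∉ B.leafSet := Finset.disjoint_left.mp hd hx'
  refine ⟨S, ⟨a1, b1⟩, ⟨hd, a2, b2⟩, ⟨by positivity, by positivity, a3, b3⟩, hstrict,
    xs, hxsS, x', hx'S, ?_, ?_, ?_, ?_⟩
  · rintro rfl
    exact hx'B hxs
  · intro y hy hne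
    refine lt_of_le_of_ne ?_ (fun h => hne (hstrict hy hxsS h))
    rcases (hmem y).1 hy with h | h
    · linarith [cA y h, cB xs hxs]
    · exact hmax y h
  · intro y hy hne
    refine lt_of_le_of_ne ?_ (fun h => hne (hstrict hx'S hy h).symm)
    rcases (hmem y).1 hy with h | h
    · exact hmin y h
    · linarith [cB y h, cA x' hx']
  · have hYB : B.leafSet ⊆ S.leafSet \ {x'} := by
      intro y hy
      rw [Finset.mem_sdiff, Finset.mem_singleton]
      exact ⟨(hmem y).2 (Or.inr hy), fun h => hx'B (h ▸ hy)⟩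
    have hAY : A.leafSet ∩ (S.leafSet \ {x'}) = A.leafSet.erase x' := by
      ext y
      simp only [Finset.mem_inter, Finset.mem_sdiff, Finset.mem_singleton, Finset.mem_erase, hmem]
      tauto
    have hcard : (A.leafSet.erase x').card = A.numLeaves - 1 := Finset.card_erase_of_mem hx'
    have hnd : ¬ Disjoint A.leafSet (S.leafSet \ {x'}) := by
      rw [Finset.disjoint_iff_inter_eq_empty, hAY]
      intro h
      rw [h, Finset.card_empty] at hcard
      omega
    obtain ⟨e, t, t1, t2, t3, t4⟩ := aux_restrict_some A _ a3 hnd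
    rw [hAY] at t3
    have hR : S.restrictTree (S.leafSet \ {x'}) =
        PhyloTree.node t B (A.numLeaves * K + e) (B.numLeaves * (K + M) + 0) := by
      have : S.restrict? (S.leafSet \ {x'}) = some (0,
        PhyloTree.node t B (A.numLeaves * K + e) (B.numLeaves * (K + M) + 0)) := by
        conv_lhs => rw [hS, restrict?]
        rw [← hS, t1, aux_restrict_all B _ hYB]
      rw [restrictTree, this]
    have hdt : Disjoint t.leafSet B.leafSet := by
      rw [t3]
      exact hd.mono_left (Finset.erase_subset _ _)
    have hnt : (t.numLeaves : ℝ) = A.numLeaves - 1 := by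
      rw [numLeaves, t3, hcard, Nat.cast_sub (by omega)]
      simp
    have htpos := aux_numLeaves_pos t
    have fB : ∀ x ∈ B.leafSet, (S.restrictTree (S.leafSet \ {x'})).FP x = S.FP x := by
      intro x hx
      rw [hR, aux_FP_right _ _ _ _ _ hdt hx, eB x hx]
      field_simp
      ring
    have fA : ∀ x ∈ A.leafSet.erase x', K + M + N ≤
        (S.restrictTree (S.leafSet \ {x'})).FP x := by
      intro x hx
      rw [hR, aux_FP_left _ _ _ _ _ (t3 ▸ hx)]
      have h1 := aux_FP_nonneg t t4 x
      have h2 : K + M + N ≤ (A.numLeaves * K + e) / t.numLeaves := by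
        rw [le_div_iff₀ htpos, hnt]
        nlinarith
      linarith
    rw [← hcard]
    congr 1
    ext z
    rw [Finset.mem_filter, fB xs hxs]
    have hz : z ∈ S.leafSet \ {x'} ↔ z ∈ A.leafSet.erase x' ∨ z ∈ B.leafSet := by
      constructor
      · intro h
        rw [Finset.mem_sdiff, Finset.mem_singleton, hmem] at h
        rw [Finset.mem_erase]
        tauto
      · rintro (h | h)
        · rw [← hAY] at h
          exact (Finset.mem_inter.mp h).2
        · exact hYB h
    constructor
    · rintro ⟨h1, h2⟩
      rcases hz.1 h1 with h | h
      · exact h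
      · rw [fB z h] at h2
        linarith [hmax z h]
    · intro h
      refine ⟨hz.2 (Or.inl h), ?_⟩
      have := fA z h
      rw [eB xs hxs]
      linarith [b6 xs hxs]
end

section
/- Let T be a rooted binary ultrametric caterpillar tree on X with |X| = n ≥ 3 and strictly positive edge lengths, let X' ⊂ X, and let T̃ = T_{X∖X'} be the induced subtree on X̃ := X∖X'. Then FP_T(x_i) ≥ FP_T(x_j) implies FP_{T̃}(x_i) ≥ FP_{T̃}(x_j) for all x_i, x_j ∈ X̃; that is, leaf deletion does not change the ranking order of the remaining leaves. -/
open scoped Classical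

open Phylo PhyloTree


namespace Phylo.PhyloTree

inductive Cat {α : Type} : PhyloTree α → Prop
  | leaf (x : α) : Cat (leaf x)
  | left (x : α) (t : PhyloTree α) (a b : ℝ) : Cat t → Cat (node (leaf x) t a b)
  | right (x : α) (t : PhyloTree α) (a b : ℝ) : Cat t → Cat (node t (leaf x) a b)

def nonnegL {α : Type} : PhyloTree α → Prop
  | leaf _ => True
  | node l r a b => 0 ≤ a ∧ 0 ≤ b ∧ nonnegL l ∧ nonnegL r

section
variable {α : Type} [DecidableEq α]

theorem nonnegL_of_pos (T : PhyloTree α) (h : T.posLengths) : T.nonnegL := by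
  induction T with
  | leaf x => trivial
  | node l r a b ihl ihr =>
    obtain ⟨h1, h2, h3, h4⟩ := h
    exact ⟨h1.le, h2.le, ihl h3, ihr h4⟩

theorem leafSet_nonempty (T : PhyloTree α) : T.leafSet.Nonempty := by
  induction T with
  | leaf x => simp [leafSet]
  | node l r a b ihl ihr =>
    obtain ⟨x, hx⟩ := ihl
    exact ⟨x, by simp [leafSet, hx]⟩

theorem one_le_numLeaves (T : PhyloTree α) : (1 : ℝ) ≤ (T.numLeaves : ℝ) := by
  have := Finset.card_pos.mpr (leafSet_nonempty T)
  unfold numLeaves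
  exact_mod_cast this

theorem FP_l (l r : PhyloTree α) (a b : ℝ) (x : α) (hx : x ∈ l.leafSet) :
    (node l r a b).FP x = l.FP x + a / (l.numLeaves : ℝ) := by simp [FP, hx]

theorem FP_r (l r : PhyloTree α) (a b : ℝ) (x : α) (hd : Disjoint l.leafSet r.leafSet)
    (hx : x ∈ r.leafSet) :
    (node l r a b).FP x = r.FP x + b / (r.numLeaves : ℝ) := by
  have : x ∉ l.leafSet := fun h => Finset.disjoint_left.mp hd h hx
  simp [FP, hx, this]

theorem depth_l (l r : PhyloTree α) (a b : ℝ) (x : α) (hx : x ∈ l.leafSet) :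
    (node l r a b).depth x = l.depth x + a := by simp [depth, hx]

theorem depth_r (l r : PhyloTree α) (a b : ℝ) (x : α) (hd : Disjoint l.leafSet r.leafSet)
    (hx : x ∈ r.leafSet) :
    (node l r a b).depth x = r.depth x + b := by
  have : x ∉ l.leafSet := fun h => Finset.disjoint_left.mp hd h hx
  simp [depth, hx, this]

theorem FP_le_depth (T : PhyloTree α) (h : T.nonnegL) (x : α) : T.FP x ≤ T.depth x := by
  induction T with
  | leaf x => simp [FP, depth]
  | node l r a b ihl ihr =>
    obtain ⟨h1, h2, h3, h4⟩ := h
    have e1 := div_le_self h1 (one_le_numLeaves l)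
    have e2 := div_le_self h2 (one_le_numLeaves r)
    have := ihl h3
    have := ihr h4
    simp only [FP, depth]
    split_ifs <;> linarith

theorem restrict_none (T : PhyloTree α) (Y : Finset α) (h : T.restrict? Y = none) :
    ∀ x ∈ T.leafSet, x ∉ Y := by
  induction T with
  | leaf x => simpa [restrict?, leafSet] using h
  | node l r a b ihl ihr =>
    simp only [restrict?] at h
    split at h <;> simp_all [leafSet]
    rintro x (hx | hx)
    · exact ihl x hx
    · exact ihr x hx

theorem restrict_some (T : PhyloTree α) (Y : Finset α) (hp : T.nonnegL) (hd : T.distinctLeaves)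
    (e : ℝ) (T' : PhyloTree α) (h : T.restrict? Y = some (e, T')) :
    0 ≤ e ∧ T'.nonnegL ∧ T'.distinctLeaves ∧ T'.leafSet = T.leafSet ∩ Y ∧
      ∀ x ∈ T'.leafSet, T'.depth x + e = T.depth x := by
  induction T generalizing e T' with
  | leaf x =>
    simp only [restrict?] at h
    split at h
    · rename_i hx
      simp only [Option.some.injEq, Prod.mk.injEq] at h
      obtain ⟨rfl, rfl⟩ := h
      refine ⟨le_rfl, trivial, trivial, ?_, ?_⟩
      · simp [leafSet, hx]
      · simp [depth]
    · simp at h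
  | node l r a b ihl ihr =>
    obtain ⟨h1, h2, h3, h4⟩ := hp
    obtain ⟨d1, d2, d3⟩ := hd
    simp only [restrict?] at h
    split at h
    · rename_i ea l' eb r' hl hr
      simp only [Option.some.injEq, Prod.mk.injEq] at h
      obtain ⟨rfl, rfl⟩ := h
      obtain ⟨p1, p2, p3, p4, p5⟩ := ihl h3 d2 _ _ hl
      obtain ⟨q1, q2, q3, q4, q5⟩ := ihr h4 d3 _ _ hr
      have dd : Disjoint l'.leafSet r'.leafSet := by
        rw [p4, q4]
        exact Finset.disjoint_of_subset_left Finset.inter_subset_left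
          (Finset.disjoint_of_subset_right Finset.inter_subset_left d1)
      refine ⟨le_rfl, ⟨by linarith, by linarith, p2, q2⟩, ⟨dd, p3, q3⟩, ?_, ?_⟩
      · simp only [leafSet]
        rw [p4, q4, Finset.union_inter_distrib_right]
      · intro x hx
        simp only [leafSet, Finset.mem_union] at hx
        rcases hx with hx | hx
        · have := p5 x hx
          rw [depth_l _ _ _ _ _ hx, depth_l]
          · linarith
          · rw [p4] at hx
            exact (Finset.mem_inter.mp hx).1
        · have := q5 x hx
          rw [depth_r _ _ _ _ _ dd hx, depth_r _ _ _ _ _ d1]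
          · linarith
          · rw [q4] at hx
            exact (Finset.mem_inter.mp hx).1
    · rename_i ea l' hl hr
      simp only [Option.some.injEq, Prod.mk.injEq] at h
      obtain ⟨rfl, rfl⟩ := h
      obtain ⟨p1, p2, p3, p4, p5⟩ := ihl h3 d2 _ _ hl
      have hn := restrict_none _ _ hr
      refine ⟨by linarith, p2, p3, ?_, ?_⟩
      · ext x
        have := hn x
        simp only [p4, leafSet, Finset.mem_union, Finset.mem_inter]
        tauto
      · intro x hx
        have := p5 x hx
        rw [depth_l]
        · linarith
        · rw [p4] at hx
          exact (Finset.mem_inter.mp hx).1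
    · rename_i eb r' hl hr
      simp only [Option.some.injEq, Prod.mk.injEq] at h
      obtain ⟨rfl, rfl⟩ := h
      obtain ⟨p1, p2, p3, p4, p5⟩ := ihr h4 d3 _ _ hr
      have hn := restrict_none _ _ hl
      refine ⟨by linarith, p2, p3, ?_, ?_⟩
      · ext x
        have := hn x
        simp only [p4, leafSet, Finset.mem_union, Finset.mem_inter]
        tauto
      · intro x hx
        have := p5 x hx
        rw [depth_r _ _ _ _ _ d1]
        · linarith
        · rw [p4] at hx
          exact (Finset.mem_inter.mp hx).1
    · simp at h

theorem eq_leaf_of_num (T : PhyloTree α) (hd : T.distinctLeaves) (h : T.numLeaves ≤ 1) :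
    ∃ x, T = leaf x := by
  cases T with
  | leaf x => exact ⟨x, rfl⟩
  | node l r a b =>
    exfalso
    have h1 := Finset.card_pos.mpr (leafSet_nonempty l)
    have h2 := Finset.card_pos.mpr (leafSet_nonempty r)
    have h3 := Finset.card_union_of_disjoint hd.1
    simp only [numLeaves, leafSet] at h
    omega

/-- the arithmetic core -/
theorem core (t t' : PhyloTree α) (a b e : ℝ) (Y : Finset α) (hb : 0 < b) (hp : t.posLengths)
    (hd : t.distinctLeaves) (h : t.restrict? Y = some (e, t')) (y : α)
    (hdep : t.depth y + b = a)
    (hle : a ≤ t.FP y + b / (t.numLeaves : ℝ)) :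
    a ≤ t'.FP y + (b + e) / (t'.numLeaves : ℝ) := by
  have h1 := FP_le_depth t (nonnegL_of_pos t hp) y
  have h2 : t.numLeaves ≤ 1 := by
    by_contra hc
    have : (1 : ℝ) < t.numLeaves := by exact_mod_cast not_le.mp hc
    have := div_lt_self hb this
    linarith
  obtain ⟨x, rfl⟩ := eq_leaf_of_num t hd h2
  simp only [restrict?] at h
  split at h
  · simp only [Option.some.injEq, Prod.mk.injEq] at h
    obtain ⟨rfl, rfl⟩ := h
    simpa using hle
  · simp at h

theorem main_ind (T : PhyloTree α) (hc : Cat T) (hd : T.distinctLeaves) (hp : T.posLengths)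
    (h : ℝ) (hu : ∀ x ∈ T.leafSet, T.depth x = h) (Y : Finset α) (e : ℝ) (T' : PhyloTree α)
    (hr : T.restrict? Y = some (e, T')) (i j : α) (hi : i ∈ T'.leafSet) (hj : j ∈ T'.leafSet)
    (hle : T.FP j ≤ T.FP i) : T'.FP j ≤ T'.FP i := by
  induction hc generalizing h e T' with
  | leaf x =>
    simp only [restrict?] at hr
    split at hr
    · simp only [Option.some.injEq, Prod.mk.injEq] at hr
      obtain ⟨rfl, rfl⟩ := hr
      simp [FP]
    · simp at hr
  | left x t a b _ ih =>
    have hs := restrict_some _ _ (nonnegL_of_pos _ hp) hd _ _ hr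
    obtain ⟨s1, s2, s3, s4, s5⟩ := hs
    obtain ⟨p1, p2, p3, p4⟩ := hp
    obtain ⟨d1, d2, d3⟩ := hd
    have hut : ∀ y ∈ t.leafSet, t.depth y = h - b := by
      intro y hy
      have := hu y (by simp [leafSet, hy])
      rw [depth_r _ _ _ _ _ d1 hy] at this
      linarith
    have hxx : x ∈ (leaf x).leafSet := by simp [leafSet]
    have hah : a = h := by
      have := hu x (by simp [leafSet])
      rw [depth_l _ _ _ _ _ hxx] at this
      simpa [depth] using this
    have key : ∀ e t', t.restrict? Y = some (e, t') → i ∈ t'.leafSet → j ∈ t'.leafSet →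
        t'.FP j ≤ t'.FP i := by
      intro e t' hrt hi hj
      have q4 := (restrict_some _ _ (nonnegL_of_pos _ p4) d3 _ _ hrt).2.2.2.1
      refine ih d3 p4 (h - b) hut e t' hrt hi hj ?_
      rw [FP_r _ _ _ _ j d1, FP_r _ _ _ _ i d1] at hle
      · linarith
      · rw [q4] at hi
        exact (Finset.mem_inter.mp hi).1
      · rw [q4] at hj
        exact (Finset.mem_inter.mp hj).1
    simp only [restrict?] at hr
    split at hr
    · rename_i ea l' eb r' hl hrr
      split at hl
      swap
      · simp at hl
      simp only [Option.some.injEq, Prod.mk.injEq] at hl hr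
      obtain ⟨rfl, rfl⟩ := hl
      obtain ⟨rfl, rfl⟩ := hr
      obtain ⟨q1, q2, q3, q4, q5⟩ := restrict_some _ _ (nonnegL_of_pos _ p4) d3 _ _ hrr
      have hFx : (node (leaf x) r' (a + 0) (b + eb)).FP x = a := by
        rw [FP_l _ _ _ _ _ hxx]
        simp [FP, numLeaves, leafSet]
      have hFx2 : (node (leaf x) t a b).FP x = a := by
        rw [FP_l _ _ _ _ _ hxx]
        simp [FP, numLeaves, leafSet]
      by_cases hix : i = x
      · subst hix
        have g1 := FP_le_depth _ s2 j
        have g2 := s5 j hj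
        have g3 := hu j (by rw [s4] at hj; exact (Finset.mem_inter.mp hj).1)
        linarith
      · have hi' : i ∈ r'.leafSet := by simpa [leafSet, hix] using hi
        have hit : i ∈ t.leafSet := by rw [q4] at hi'; exact (Finset.mem_inter.mp hi').1
        by_cases hjx : j = x
        · subst hjx
          rw [hFx2, FP_r _ _ _ _ _ d1 hit] at hle
          rw [hFx, FP_r _ _ _ _ _ s3.1 hi']
          exact core t r' a b eb Y p2 p4 d3 hrr i (by rw [hut i hit]; linarith) hle
        · have hj' : j ∈ r'.leafSet := by simpa [leafSet, hjx] using hj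
          rw [FP_r _ _ _ _ _ s3.1 hi', FP_r _ _ _ _ _ s3.1 hj']
          have := key _ _ hrr hi' hj'
          linarith
    · rename_i ea l' hl hrr
      split at hl
      swap
      · simp at hl
      simp only [Option.some.injEq, Prod.mk.injEq] at hl hr
      obtain ⟨rfl, rfl⟩ := hl
      obtain ⟨rfl, rfl⟩ := hr
      simp [FP]
    · rename_i eb r' hl hrr
      simp only [Option.some.injEq, Prod.mk.injEq] at hr
      obtain ⟨rfl, rfl⟩ := hr
      exact key _ _ hrr hi hj
    · simp at hr
  | right x t a b _ ih =>
    have hs := restrict_some _ _ (nonnegL_of_pos _ hp) hd _ _ hr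
    obtain ⟨s1, s2, s3, s4, s5⟩ := hs
    obtain ⟨p1, p2, p3, p4⟩ := hp
    obtain ⟨d1, d2, d3⟩ := hd
    have hut : ∀ y ∈ t.leafSet, t.depth y = h - a := by
      intro y hy
      have := hu y (by simp [leafSet, hy])
      rw [depth_l _ _ _ _ _ hy] at this
      linarith
    have hxx : x ∈ (leaf x).leafSet := by simp [leafSet]
    have hah : b = h := by
      have := hu x (by simp [leafSet])
      rw [depth_r _ _ _ _ _ d1 hxx] at this
      simpa [depth] using this
    have key : ∀ e t', t.restrict? Y = some (e, t') → i ∈ t'.leafSet → j ∈ t'.leafSet →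
        t'.FP j ≤ t'.FP i := by
      intro e t' hrt hi hj
      have q4 := (restrict_some _ _ (nonnegL_of_pos _ p3) d2 _ _ hrt).2.2.2.1
      refine ih d2 p3 (h - a) hut e t' hrt hi hj ?_
      rw [FP_l _ _ _ _ j, FP_l _ _ _ _ i] at hle
      · linarith
      · rw [q4] at hi
        exact (Finset.mem_inter.mp hi).1
      · rw [q4] at hj
        exact (Finset.mem_inter.mp hj).1
    simp only [restrict?] at hr
    split at hr
    · rename_i ea l' eb r' hrr hl
      split at hl
      swap
      · simp at hl
      simp only [Option.some.injEq, Prod.mk.injEq] at hl hr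
      obtain ⟨rfl, rfl⟩ := hl
      obtain ⟨rfl, rfl⟩ := hr
      obtain ⟨q1, q2, q3, q4, q5⟩ := restrict_some _ _ (nonnegL_of_pos _ p3) d2 _ _ hrr
      have hFx : (node l' (leaf x) (a + ea) (b + 0)).FP x = b := by
        rw [FP_r _ _ _ _ _ s3.1 hxx]
        simp [FP, numLeaves, leafSet]
      have hFx2 : (node t (leaf x) a b).FP x = b := by
        rw [FP_r _ _ _ _ _ d1 hxx]
        simp [FP, numLeaves, leafSet]
      by_cases hix : i = x
      · subst hix
        have g1 := FP_le_depth _ s2 j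
        have g2 := s5 j hj
        have g3 := hu j (by rw [s4] at hj; exact (Finset.mem_inter.mp hj).1)
        linarith
      · have hi' : i ∈ l'.leafSet := by simpa [leafSet, hix] using hi
        have hit : i ∈ t.leafSet := by rw [q4] at hi'; exact (Finset.mem_inter.mp hi').1
        by_cases hjx : j = x
        · subst hjx
          rw [hFx2, FP_l _ _ _ _ _ hit] at hle
          rw [hFx, FP_l _ _ _ _ _ hi']
          exact core t l' b a ea Y p1 p3 d2 hrr i (by rw [hut i hit]; linarith) hle
        · have hj' : j ∈ l'.leafSet := by simpa [leafSet, hjx] using hj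
          rw [FP_l _ _ _ _ _ hi', FP_l _ _ _ _ _ hj']
          have := key _ _ hrr hi' hj'
          linarith
    · rename_i ea l' hrr hl
      simp only [Option.some.injEq, Prod.mk.injEq] at hr
      obtain ⟨rfl, rfl⟩ := hr
      exact key _ _ hrr hi hj
    · rename_i eb r' hrr hl
      split at hl
      swap
      · simp at hl
      simp only [Option.some.injEq, Prod.mk.injEq] at hl hr
      obtain ⟨rfl, rfl⟩ := hl
      obtain ⟨rfl, rfl⟩ := hr
      simp [FP]
    · simp at hr

theorem cherries_mem (T : PhyloTree α) (p : α × α) (h : p ∈ T.cherries) : p.1 ∈ T.leafSet := by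
  induction T with
  | leaf x => simp [cherries] at h
  | node l r a b ihl ihr =>
    cases l <;> cases r <;> simp_all [cherries, leafSet] <;> tauto

theorem cherries_nonempty' (T : PhyloTree α) : (∃ x, T = leaf x) ∨ T.cherries.Nonempty := by
  induction T with
  | leaf x => exact Or.inl ⟨x, rfl⟩
  | node l r a b ihl ihr =>
    right
    cases l with
    | leaf x =>
      cases r with
      | leaf y => simp [cherries]
      | node =>
        simp only [reduceCtorEq, exists_false, false_or] at ihr
        obtain ⟨p, hp⟩ := ihr
        exact ⟨p, by rw [cherries]; exacts [Finset.mem_union_right _ hp, by simp]⟩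
    | node =>
      simp only [reduceCtorEq, exists_false, false_or] at ihl
      obtain ⟨p, hp⟩ := ihl
      exact ⟨p, by rw [cherries]; exacts [Finset.mem_union_left _ hp, by simp]⟩

theorem cherries_nonempty (l r : PhyloTree α) (a b : ℝ) : (node l r a b).cherries.Nonempty := by
  simpa using cherries_nonempty' (node l r a b)

theorem cat_of_card (T : PhyloTree α) (hd : T.distinctLeaves) (h : T.cherries.card ≤ 1) :
    Cat T := by
  induction T with
  | leaf x => exact Cat.leaf x
  | node l r a b ihl ihr =>
    obtain ⟨d1, d2, d3⟩ := hd
    cases l with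
    | leaf x =>
      refine Cat.left _ _ _ _ (ihr d3 ?_)
      cases r with
      | leaf y => simp [cherries]
      | node => simpa [cherries] using h
    | node l1 l2 a1 b1 =>
      cases r with
      | leaf y =>
        refine Cat.right _ _ _ _ (ihl d2 ?_)
        simpa [cherries] using h
      | node r1 r2 a2 b2 =>
        exfalso
        obtain ⟨p, hp⟩ := cherries_nonempty l1 l2 a1 b1
        obtain ⟨q, hq⟩ := cherries_nonempty r1 r2 a2 b2
        have hpq : p = q := by
          rw [Finset.card_le_one] at h
          apply h
          · rw [cherries]
            · exact Finset.mem_union_left _ hp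
            · simp
          · rw [cherries]
            · exact Finset.mem_union_right _ hq
            · simp
        subst hpq
        exact Finset.disjoint_left.mp d1 (cherries_mem _ _ hp) (cherries_mem _ _ hq)

end

end Phylo.PhyloTree

/-- For an ultrametric caterpillar tree, the deletion of any proper subset
`X'` of the leaves does not change the FP ranking order of the remaining leaves. -/
theorem ultrametric_caterpillar_ranking_preserved {α : Type} [DecidableEq α]
    (T : PhyloTree α) (hleaf : T.distinctLeaves) (hpos : T.posLengths)
    (hn : 3 ≤ T.numLeaves) (hcat : T.cherries.card = 1) (hum : T.ultrametric)
    (X' : Finset α) (hX' : X' ⊂ T.leafSet) :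
    ∀ xi ∈ T.leafSet \ X', ∀ xj ∈ T.leafSet \ X',
      T.FP xj ≤ T.FP xi →
      (T.restrictTree (T.leafSet \ X')).FP xj ≤ (T.restrictTree (T.leafSet \ X')).FP xi := by
  intro i hi j hj hle
  obtain ⟨x0, hx0⟩ := leafSet_nonempty T
  cases hr : T.restrict? (T.leafSet \ X') with
  | none => exact absurd hi (restrict_none _ _ hr i (Finset.mem_sdiff.mp hi).1)
  | some p =>
    obtain ⟨e, T'⟩ := p
    have hT : T.restrictTree (T.leafSet \ X') = T' := by simp [restrictTree, hr]
    rw [hT]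
    have s4 := (restrict_some _ _ (nonnegL_of_pos _ hpos) hleaf _ _ hr).2.2.2.1
    refine main_ind T (cat_of_card T hleaf hcat.le) hleaf hpos (T.depth x0)
      (fun x hx => hum x hx x0 hx0) _ e T' hr i j ?_ ?_ hle
    · rw [s4]
      exact Finset.mem_inter.mpr ⟨(Finset.mem_sdiff.mp hi).1, hi⟩
    · rw [s4]
      exact Finset.mem_inter.mpr ⟨(Finset.mem_sdiff.mp hj).1, hj⟩
end
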